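/- Let d ≥ 1, T > 0, c > 0, ϖ > 0, and let Z : ℝ^d × {(t,s) : 0 ≤ s < t ≤ T} × ℝ^d → ℝ, (w,t,s,𝔷) ↦ Z(w,t,s,𝔷), be measurable, continuously differentiable in w for each fixed (t,s,𝔷), with the gradient ∇_w Z jointly measurable, and satisfying |Z(w,t,s,𝔷)| ≤ g_{c,ϖ}(w, t−s) and |∇_w Z(w,t,s,𝔷)| ≤ (t−s)^{−1/2} g_{c,ϖ}(w, t−s). Let f : ℝ^d × [0,T] → ℝ be measurable with |f(x,t)| ≤ k exp(a|x|²) for some k > 0 and 0 < a < ϖ/T. Then for every x ∈ ℝ^d and 0 < t ≤ T the integral F(x,t) = ∫_0^t ∫_{ℝ^d} Z(x−ζ, t, s, ζ) f(ζ,s) dζ ds converges absolutely, the map x ↦ F(x,t) is differentiable, and ∇_x F(x,t) = ∫_0^t ∫_{ℝ^d} ∇_w Z(x−ζ, t, s, ζ) f(ζ,s) dζ ds. -/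

import Mathlib

open MeasureTheory Real

/-- The Gaussian kernel `g_{c,C}(x,t) = c · t^{-d/2} · exp(-C|x|²/t)`. -/
noncomputable def gker (d : ℕ) (c C : ℝ) (x : EuclideanSpace ℝ (Fin d)) (t : ℝ) : ℝ :=
  c / t ^ ((d : ℝ) / 2) * Real.exp (-C * ‖x‖ ^ 2 / t)

theorem stmt8_grad {E α : Type*} [NormedAddCommGroup E] [InnerProductSpace ℝ E] [CompleteSpace E]
    [MeasurableSpace α] {μ : Measure α} (F : E → α → ℝ) (F' : E → α → E) (x₀ : E) (bound : α → ℝ)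
    (hFm : ∀ x, AEStronglyMeasurable (F x) μ) (hFi : Integrable (F x₀) μ)
    (hF'm : AEStronglyMeasurable (F' x₀) μ)
    (hb : ∀ᵐ p ∂μ, ∀ x ∈ Metric.ball x₀ 1, ‖F' x p‖ ≤ bound p)
    (hbi : Integrable bound μ)
    (hd : ∀ᵐ p ∂μ, ∀ x ∈ Metric.ball x₀ 1, HasGradientAt (fun x => F x p) (F' x p) x) :
    HasGradientAt (fun x => ∫ p, F x p ∂μ) (∫ p, F' x₀ p ∂μ) x₀ := by
  let L : E →L[ℝ] E →L[ℝ] ℝ := innerSL ℝ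
  have hF'i : Integrable (F' x₀) μ := by
    refine hbi.mono' hF'm ?_
    filter_upwards [hb] with p hp
    exact hp x₀ (Metric.mem_ball_self one_pos)
  have h := hasFDerivAt_integral_of_dominated_of_fderiv_le (𝕜 := ℝ) (μ := μ) (F := F)
    (F' := fun x p => L (F' x p)) (x₀ := x₀) (bound := bound) (s := Metric.ball x₀ 1)
    (Metric.ball_mem_nhds x₀ one_pos) (Filter.Eventually.of_forall hFm) hFi
    (L.continuous.comp_aestronglyMeasurable hF'm)
    (by
      filter_upwards [hb] with p hp x hx
      have : ‖L (F' x p)‖ = ‖F' x p‖ := innerSL_apply_norm (𝕜 := ℝ) (F' x p)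
      rw [this]; exact hp x hx) hbi
    (by
      filter_upwards [hd] with p hp x hx
      exact (hp x hx).hasFDerivAt)
  rw [L.integral_comp_comm hF'i] at h
  exact h

theorem stmt8_exp {E : Type*} [NormedAddCommGroup E] {T ϖ a : ℝ} (hT : 0 < T)
    (ha0 : 0 < a) (haT : a < ϖ / T) : ∃ b K : ℝ, 0 < b ∧ 0 ≤ K ∧ ∀ (x ζ : E) (τ : ℝ), 0 < τ → τ ≤ T →
      Real.exp (-ϖ * ‖x - ζ‖ ^ 2 / τ) * Real.exp (a * ‖ζ‖ ^ 2) ≤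
        Real.exp (K * ‖x‖ ^ 2) * Real.exp (-(b / τ) * ‖x - ζ‖ ^ 2) := by
  have h1 : a * T < ϖ := (lt_div_iff₀ hT).1 haT
  obtain ⟨η, hη, hη'⟩ : ∃ η, 0 < η ∧ a * η * T = (ϖ - a * T) / 2 :=
    ⟨(ϖ - a * T) / (2 * (a * T)), div_pos (by linarith) (by positivity), by field_simp⟩
  refine ⟨(ϖ - a * T) / 2, a * (1 + 1 / η), by linarith, by positivity, fun x ζ τ h0 hτ => ?_⟩
  rw [← Real.exp_add, ← Real.exp_add, Real.exp_le_exp]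
  have tri : ‖ζ‖ ≤ ‖x - ζ‖ + ‖x‖ := by
    have := norm_sub_le x (x - ζ)
    rw [sub_sub_cancel] at this; linarith
  have hsq : ‖ζ‖ ^ 2 ≤ (1 + η) * ‖x - ζ‖ ^ 2 + (1 + 1 / η) * ‖x‖ ^ 2 := by
    have h2 : ‖ζ‖ ^ 2 ≤ (‖x - ζ‖ + ‖x‖) ^ 2 := by gcongr
    have h3 : 0 ≤ (η * ‖x - ζ‖ - ‖x‖) ^ 2 / η := by positivity
    have h4 : (η * ‖x - ζ‖ - ‖x‖) ^ 2 / η = η * ‖x - ζ‖ ^ 2 - 2 * ‖x - ζ‖ * ‖x‖ + 1 / η * ‖x‖ ^ 2 := by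
      field_simp; ring
    nlinarith
  have h5 : a * (1 + η) ≤ (ϖ + a * T) / 2 / τ := by
    rw [le_div_iff₀ h0]
    have : a * (1 + η) * τ ≤ a * (1 + η) * T := by gcongr
    nlinarith
  have h6 := mul_le_mul_of_nonneg_right h5 (sq_nonneg ‖x - ζ‖)
  have h7 := mul_le_mul_of_nonneg_left hsq ha0.le
  have h8 : -ϖ * ‖x - ζ‖ ^ 2 / τ + (ϖ + a * T) / 2 / τ * ‖x - ζ‖ ^ 2 =
    -((ϖ - a * T) / 2 / τ) * ‖x - ζ‖ ^ 2 := by field_simp; ring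
  nlinarith

theorem stmt8_gauss_int (d : ℕ) {β : ℝ} (hβ : 0 < β) (x : EuclideanSpace ℝ (Fin d)) :
    Integrable (fun ζ : EuclideanSpace ℝ (Fin d) => Real.exp (-β * ‖x - ζ‖ ^ 2)) ∧
    ∫ ζ : EuclideanSpace ℝ (Fin d), Real.exp (-β * ‖x - ζ‖ ^ 2) = (π / β) ^ ((d : ℝ) / 2) := by
  have h2 := GaussianFourier.integral_rexp_neg_mul_sq_norm (V := EuclideanSpace ℝ (Fin d)) hβ
  rw [finrank_euclideanSpace_fin] at h2
  have h1 : Integrable (fun ζ : EuclideanSpace ℝ (Fin d) => Real.exp (-β * ‖ζ‖ ^ 2)) := by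
    by_contra h
    rw [integral_undef h] at h2
    have : 0 < (π / β) ^ ((d : ℝ) / 2) := by positivity
    linarith
  refine ⟨h1.comp_sub_left x, ?_⟩
  rw [← h2]
  exact integral_sub_left_eq_self (fun ζ : EuclideanSpace ℝ (Fin d) => Real.exp (-β * ‖ζ‖ ^ 2)) volume x

/-- Differentiation of a volume potential under the integral sign: if the
parametrix `Z(w,t,s,𝔷)` and its gradient in `w` satisfy Gaussian bounds and `f`
has subgaussian growth `|f(x,t)| ≤ k·exp(a|x|²)` with `a < ϖ/T`, then
`F(x,t) = ∫_0^t ∫ Z(x-ζ,t,s,ζ) f(ζ,s) dζ ds` converges absolutely, is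
differentiable in `x`, and its gradient is obtained by differentiating under
the integral. -/
theorem stmt8 (d : ℕ) (hd : 1 ≤ d) (T c ϖ : ℝ) (hT : 0 < T) (hc : 0 < c) (hϖ : 0 < ϖ)
    (Z : EuclideanSpace ℝ (Fin d) → ℝ → ℝ → EuclideanSpace ℝ (Fin d) → ℝ)
    (G : EuclideanSpace ℝ (Fin d) → ℝ → ℝ → EuclideanSpace ℝ (Fin d) →
      EuclideanSpace ℝ (Fin d))
    (hZmeas : Measurable fun p : EuclideanSpace ℝ (Fin d) × ℝ × ℝ ×
      EuclideanSpace ℝ (Fin d) => Z p.1 p.2.1 p.2.2.1 p.2.2.2)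
    (hGmeas : Measurable fun p : EuclideanSpace ℝ (Fin d) × ℝ × ℝ ×
      EuclideanSpace ℝ (Fin d) => G p.1 p.2.1 p.2.2.1 p.2.2.2)
    (hZdiff : ∀ (t s : ℝ) (𝔷 w : EuclideanSpace ℝ (Fin d)),
      HasGradientAt (fun w => Z w t s 𝔷) (G w t s 𝔷) w)
    (hGcont : ∀ (t s : ℝ) (𝔷 : EuclideanSpace ℝ (Fin d)),
      Continuous fun w => G w t s 𝔷)
    (hZbound : ∀ (w : EuclideanSpace ℝ (Fin d)) (t s : ℝ)
      (𝔷 : EuclideanSpace ℝ (Fin d)), 0 ≤ s → s < t → t ≤ T →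
      |Z w t s 𝔷| ≤ gker d c ϖ w (t - s))
    (hGbound : ∀ (w : EuclideanSpace ℝ (Fin d)) (t s : ℝ)
      (𝔷 : EuclideanSpace ℝ (Fin d)), 0 ≤ s → s < t → t ≤ T →
      ‖G w t s 𝔷‖ ≤ (t - s) ^ (-(1 : ℝ) / 2) * gker d c ϖ w (t - s))
    (f : EuclideanSpace ℝ (Fin d) → ℝ → ℝ)
    (hfmeas : Measurable fun p : EuclideanSpace ℝ (Fin d) × ℝ => f p.1 p.2)
    (k a : ℝ) (hk : 0 < k) (ha0 : 0 < a) (haT : a < ϖ / T)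
    (hfbound : ∀ (x : EuclideanSpace ℝ (Fin d)), ∀ t ∈ Set.Icc (0 : ℝ) T,
      |f x t| ≤ k * Real.exp (a * ‖x‖ ^ 2)) :
    ∀ (x : EuclideanSpace ℝ (Fin d)) (t : ℝ), 0 < t → t ≤ T →
      Integrable (fun p : ℝ × EuclideanSpace ℝ (Fin d) =>
          Z (x - p.2) t p.1 p.2 * f p.2 p.1)
        ((volume.restrict (Set.Ioo 0 t)).prod volume) ∧
      HasGradientAt
        (fun x : EuclideanSpace ℝ (Fin d) =>
          ∫ s in (0 : ℝ)..t, ∫ ζ : EuclideanSpace ℝ (Fin d),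
            Z (x - ζ) t s ζ * f ζ s)
        (∫ s in (0 : ℝ)..t, ∫ ζ : EuclideanSpace ℝ (Fin d),
          f ζ s • G (x - ζ) t s ζ) x := by
  intro x₀ t ht htT
  obtain ⟨b, K, hb, hK, hexp⟩ := stmt8_exp (E := EuclideanSpace ℝ (Fin d)) hT ha0 haT
  -- measurability of the integrands
  have mZ : ∀ x : EuclideanSpace ℝ (Fin d), Measurable
      (fun p : ℝ × EuclideanSpace ℝ (Fin d) => Z (x - p.2) t p.1 p.2 * f p.2 p.1) := by
    intro x
    refine Measurable.mul (hZmeas.comp (f := fun p : ℝ × EuclideanSpace ℝ (Fin d) =>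
      (x - p.2, t, p.1, p.2)) (by fun_prop)) (hfmeas.comp (f := fun p : ℝ × EuclideanSpace ℝ (Fin d) =>
      (p.2, p.1)) (by fun_prop))
  have mG : ∀ x : EuclideanSpace ℝ (Fin d), Measurable
      (fun p : ℝ × EuclideanSpace ℝ (Fin d) => f p.2 p.1 • G (x - p.2) t p.1 p.2) := by
    intro x
    refine Measurable.smul (hfmeas.comp (f := fun p : ℝ × EuclideanSpace ℝ (Fin d) =>
      (p.2, p.1)) (by fun_prop)) (hGmeas.comp (f := fun p : ℝ × EuclideanSpace ℝ (Fin d) =>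
      (x - p.2, t, p.1, p.2)) (by fun_prop))
  have mZs : ∀ (x : EuclideanSpace ℝ (Fin d)) (s : ℝ), Measurable
      (fun ζ : EuclideanSpace ℝ (Fin d) => Z (x - ζ) t s ζ * f ζ s) := fun x s =>
    (mZ x).comp (measurable_prodMk_left (x := s))
  have mGs : ∀ (x : EuclideanSpace ℝ (Fin d)) (s : ℝ), Measurable
      (fun ζ : EuclideanSpace ℝ (Fin d) => f ζ s • G (x - ζ) t s ζ) := fun x s =>
    (mG x).comp (measurable_prodMk_left (x := s))
  -- pointwise bounds
  let A : EuclideanSpace ℝ (Fin d) → ℝ := fun x => k * c * Real.exp (K * ‖x‖ ^ 2)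
  have hA : ∀ x, 0 ≤ A x := fun x => by positivity
  let H : EuclideanSpace ℝ (Fin d) → ℝ → EuclideanSpace ℝ (Fin d) → ℝ := fun x s ζ =>
    A x / (t - s) ^ ((d : ℝ) / 2) * Real.exp (-(b / (t - s)) * ‖x - ζ‖ ^ 2)
  have hH : ∀ x ζ s, 0 < s → s < t → gker d c ϖ (x - ζ) (t - s) * |f ζ s| ≤ H x s ζ := by
    intro x ζ s h0 hs
    have hτ : 0 < t - s := by linarith
    have hp : 0 < (t - s) ^ ((d : ℝ) / 2) := by positivity
    have h1 := hexp x ζ (t - s) hτ (by linarith)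
    have h2 := hfbound ζ s ⟨h0.le, by linarith⟩
    calc gker d c ϖ (x - ζ) (t - s) * |f ζ s|
        ≤ gker d c ϖ (x - ζ) (t - s) * (k * Real.exp (a * ‖ζ‖ ^ 2)) := by
          refine mul_le_mul_of_nonneg_left h2 ?_
          unfold gker; positivity
      _ = (c * k / (t - s) ^ ((d : ℝ) / 2)) * (Real.exp (-ϖ * ‖x - ζ‖ ^ 2 / (t - s)) *
            Real.exp (a * ‖ζ‖ ^ 2)) := by unfold gker; ring
      _ ≤ (c * k / (t - s) ^ ((d : ℝ) / 2)) * (Real.exp (K * ‖x‖ ^ 2) *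
            Real.exp (-(b / (t - s)) * ‖x - ζ‖ ^ 2)) := by gcongr
      _ = H x s ζ := by simp only [H, A]; ring
  have bZ : ∀ x ζ s, 0 < s → s < t → ‖Z (x - ζ) t s ζ * f ζ s‖ ≤ H x s ζ := by
    intro x ζ s h0 hs
    rw [norm_mul, Real.norm_eq_abs, Real.norm_eq_abs]
    exact (mul_le_mul_of_nonneg_right (hZbound _ t s ζ h0.le hs htT) (abs_nonneg _)).trans
      (hH x ζ s h0 hs)
  have bG : ∀ x ζ s, 0 < s → s < t →
      ‖f ζ s • G (x - ζ) t s ζ‖ ≤ (t - s) ^ (-(1 : ℝ) / 2) * H x s ζ := by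
    intro x ζ s h0 hs
    have hτ : 0 < t - s := by linarith
    rw [norm_smul, Real.norm_eq_abs, mul_comm]
    refine (mul_le_mul_of_nonneg_right (hGbound _ t s ζ h0.le hs htT) (abs_nonneg _)).trans ?_
    rw [mul_assoc]
    exact mul_le_mul_of_nonneg_left (hH x ζ s h0 hs) (by positivity)
  have iH : ∀ x s, s < t → Integrable (H x s) ∧
      ∫ ζ, H x s ζ = A x * (π / b) ^ ((d : ℝ) / 2) := by
    intro x s hs
    have hτ : 0 < t - s := by linarith
    obtain ⟨h1, h2⟩ := stmt8_gauss_int d (div_pos hb hτ) x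
    refine ⟨h1.const_mul _, ?_⟩
    simp only [H]
    rw [integral_const_mul, h2]
    have : π / (b / (t - s)) = (π / b) * (t - s) := by field_simp
    rw [this, Real.mul_rpow (by positivity) hτ.le]
    have hp : 0 < (t - s) ^ ((d : ℝ) / 2) := by positivity
    field_simp
  have iZs : ∀ x s, 0 < s → s < t → Integrable (fun ζ => Z (x - ζ) t s ζ * f ζ s) :=
    fun x s h0 hs => (iH x s hs).1.mono' (mZs x s).aestronglyMeasurable
      (Filter.Eventually.of_forall fun ζ => bZ x ζ s h0 hs)
  -- absolute convergence
  have part1 : ∀ x, Integrable (fun p : ℝ × EuclideanSpace ℝ (Fin d) =>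
          Z (x - p.2) t p.1 p.2 * f p.2 p.1)
        ((volume.restrict (Set.Ioo 0 t)).prod volume) := by
    intro x
    rw [integrable_prod_iff (mZ x).aestronglyMeasurable]
    constructor
    · filter_upwards [ae_restrict_mem measurableSet_Ioo] with s hs
      exact iZs x s hs.1 hs.2
    · refine Integrable.mono' (integrable_const (A x * (π / b) ^ ((d : ℝ) / 2)))
        (mZ x).norm.stronglyMeasurable.integral_prod_right.aestronglyMeasurable ?_
      filter_upwards [ae_restrict_mem measurableSet_Ioo] with s hs
      rw [Real.norm_of_nonneg (integral_nonneg fun _ => norm_nonneg _), ← (iH x s hs.2).2]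
      exact integral_mono (iZs x s hs.1 hs.2).norm (iH x s hs.2).1 fun ζ => bZ x ζ s hs.1 hs.2
  refine ⟨part1 x₀, ?_⟩
  -- uniform control of the constant on a unit ball
  have hAb : ∀ y : EuclideanSpace ℝ (Fin d), ∀ x ∈ Metric.ball y 1,
      A x ≤ k * c * Real.exp (K * (‖y‖ + 1) ^ 2) := by
    intro y x hx
    have h1 : ‖x - y‖ < 1 := by rwa [mem_ball_iff_norm] at hx
    have h2 : ‖x‖ ≤ ‖y‖ + 1 := by
      have := norm_add_le y (x - y)
      rw [add_sub_cancel] at this; linarith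
    simp only [A]
    gcongr
  -- differentiate the spatial integral
  have inner_diff : ∀ s, 0 < s → s < t → ∀ y : EuclideanSpace ℝ (Fin d),
      HasGradientAt (fun x => ∫ ζ, Z (x - ζ) t s ζ * f ζ s)
        (∫ ζ, f ζ s • G (y - ζ) t s ζ) y := by
    intro s h0 hs y
    have hτ : 0 < t - s := by linarith
    have hβ : 0 < b / (t - s) := div_pos hb hτ
    refine stmt8_grad (fun x ζ => Z (x - ζ) t s ζ * f ζ s) (fun x ζ => f ζ s • G (x - ζ) t s ζ) y
      (fun ζ => (t - s) ^ (-(1 : ℝ) / 2) * (k * c * Real.exp (K * (‖y‖ + 1) ^ 2) /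
        (t - s) ^ ((d : ℝ) / 2) * Real.exp (b / (t - s))) *
          Real.exp (-(b / (t - s) / 2) * ‖y - ζ‖ ^ 2))
      (fun x => (mZs x s).aestronglyMeasurable) (iZs y s h0 hs) (mGs y s).aestronglyMeasurable
      (Filter.Eventually.of_forall fun ζ x hx => ?_)
      ((stmt8_gauss_int d (half_pos hβ) y).1.const_mul _)
      (Filter.Eventually.of_forall fun ζ x _ => ?_)
    · refine (bG x ζ s h0 hs).trans ?_
      rw [mul_assoc ((t - s) ^ (-(1 : ℝ) / 2)), mul_assoc (_ / _) (Real.exp (b / (t - s))),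
        ← Real.exp_add]
      simp only [H]
      have h1 : ‖x - y‖ < 1 := by rwa [mem_ball_iff_norm] at hx
      have h2 : ‖y - ζ‖ ≤ 1 + ‖x - ζ‖ := by
        have := norm_sub_le (x - ζ) (x - y)
        rw [sub_sub_sub_cancel_left] at this; linarith
      have h3 : ‖y - ζ‖ ^ 2 ≤ 2 * ‖x - ζ‖ ^ 2 + 2 := by
        have : ‖y - ζ‖ ^ 2 ≤ (1 + ‖x - ζ‖) ^ 2 := by gcongr
        nlinarith [sq_nonneg (1 - ‖x - ζ‖)]
      have h4 : -(b / (t - s)) * ‖x - ζ‖ ^ 2 ≤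
          b / (t - s) + -(b / (t - s) / 2) * ‖y - ζ‖ ^ 2 := by nlinarith
      have h5 := hAb y x hx
      gcongr
    · have h1 := (hZdiff t s ζ (x - ζ)).hasFDerivAt
      have h2 : HasFDerivAt (fun x : EuclideanSpace ℝ (Fin d) => x - ζ)
        (ContinuousLinearMap.id ℝ _) x := (hasFDerivAt_id x).sub_const ζ
      have h3 := (h1.comp x h2).mul_const (f ζ s)
      rw [hasGradientAt_iff_hasFDerivAt]
      refine h3.congr_fderiv ?_
      ext v
      simp
  -- differentiate the time integral
  simp only [intervalIntegral.integral_of_le ht.le, integral_Ioc_eq_integral_Ioo]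
  refine stmt8_grad (fun x s => ∫ ζ, Z (x - ζ) t s ζ * f ζ s)
    (fun x s => ∫ ζ, f ζ s • G (x - ζ) t s ζ) x₀
    (fun s => (t - s) ^ (-(1 : ℝ) / 2) * (k * c * Real.exp (K * (‖x₀‖ + 1) ^ 2) *
      (π / b) ^ ((d : ℝ) / 2)))
    (fun x => (mZ x).stronglyMeasurable.integral_prod_right.aestronglyMeasurable)
    (part1 x₀).integral_prod_left
    (mG x₀).stronglyMeasurable.integral_prod_right.aestronglyMeasurable ?_ ?_ ?_
  · filter_upwards [ae_restrict_mem measurableSet_Ioo] with s hs x hx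
    have hτ : 0 < t - s := by linarith [hs.2]
    refine (norm_integral_le_of_norm_le ((iH x s hs.2).1.const_mul _)
      (Filter.Eventually.of_forall fun ζ => bG x ζ s hs.1 hs.2)).trans ?_
    rw [integral_const_mul, (iH x s hs.2).2]
    have h5 := hAb x₀ x hx
    gcongr
  · refine Integrable.mul_const ?_ _
    have h := (intervalIntegral.intervalIntegrable_rpow' (a := 0) (b := t)
      (r := -(1 : ℝ) / 2) (by norm_num)).comp_sub_left t
    rw [sub_zero, sub_self] at h
    have h' := h.symm
    rw [intervalIntegrable_iff_integrableOn_Ioo_of_le ht.le] at h'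
    exact h'
  · filter_upwards [ae_restrict_mem measurableSet_Ioo] with s hs x hx
    exact inner_diff s hs.1 hs.2 x
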